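/- Let F = ℚ(√d) be a real quadratic field, H a totally definite quaternion F-algebra, and 𝒪 an O_F-order in H. Let 𝒪¹ = {u ∈ 𝒪^× : Nr(u) = 1} be the reduced-norm-one subgroup. Then the index [𝒪^× : O_F^×·𝒪¹] is 1 or 2; moreover, if Nm_{F/ℚ}(ε) = −1 for the fundamental unit ε of F, then 𝒪^× = O_F^×·𝒪¹. -/

import Mathlib

open NumberField Quaternion

noncomputable section

namespace QuatPaper

variable (F : Type) [Field F] [NumberField F]

def scalarSet (H : Type) [Ring H] [Algebra F H] : Set H :=
  Set.range fun r : 𝓞 F => algebraMap F H (algebraMap (𝓞 F) F r)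

def IsOrder {H : Type} [Ring H] [Algebra F H] (O : Subring H) : Prop :=
  scalarSet F H ⊆ ↑O ∧ O.toAddSubgroup.FG ∧ Submodule.span F (O : Set H) = ⊤

def IsMaximalOrder {H : Type} [Ring H] [Algebra F H] (O : Subring H) : Prop :=
  IsOrder F O ∧ ∀ O' : Subring H, IsOrder F O' → O ≤ O' → O' = O

def IsScalarUnit {H : Type} [Ring H] [Algebra F H] {O : Subring H} (u : (↥O)ˣ) : Prop :=
  ∃ r : (𝓞 F)ˣ, ((u : ↥O) : H) = algebraMap F H (algebraMap (𝓞 F) F ↑r)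

def RedUnitIso {H : Type} [Ring H] [Algebra F H] (O : Subring H) (G : Type*) [Group G] : Prop :=
  ∃ φ : (↥O)ˣ →* G, Function.Surjective φ ∧ ∀ u, φ u = 1 ↔ IsScalarUnit F u

def IsConjugate {H : Type} [Ring H] (x : Hˣ) (O O' : Subring H) : Prop :=
  ∀ y : H, y ∈ O ↔ (x : H) * y * ((x⁻¹ : Hˣ) : H) ∈ O'

def ConjRel {H : Type} [Ring H] (O O' : Subring H) : Prop :=
  ∃ x : Hˣ, IsConjugate x O O'

def typeNum (H : Type) [Ring H] [Algebra F H] (G : Type*) [Group G] : ℕ :=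
  Nat.card (Quot fun O O' : {O : Subring H // IsMaximalOrder F O ∧ RedUnitIso F O G} =>
    ConjRel O.1 O'.1)

def IsQuatAlg (H : Type) [Ring H] [Algebra F H] : Prop :=
  ∃ a b : F, a ≠ 0 ∧ b ≠ 0 ∧ Nonempty (H ≃ₐ[F] ℍ[F, a, b])

def TotallyDefinite (H : Type) [Ring H] [Algebra F H] : Prop :=
  ∀ σ : F →+* ℝ,
    letI : Algebra F ℝ := σ.toAlgebra
    ∀ x : TensorProduct F ℝ H, x ≠ 0 → IsUnit x

/-- The reduced norm `Nr(x) = x·x̄` of a quaternion `x ∈ ℍ[F, A, B]`. -/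
def redNorm {A B : F} (x : ℍ[F, A, B]) : F := (x * star x).re

theorem redNorm_eq {K : Type} [Field K] {A B : K} (x : ℍ[K, A, B]) :
    redNorm K x = x.re ^ 2 - A * x.imI ^ 2 - B * x.imJ ^ 2 + A * B * x.imK ^ 2 := by
  simp [redNorm]
  ring

/-- The reduced norm as a monoid homomorphism. -/
def redNormHom {K : Type} [Field K] (A B : K) : ℍ[K, A, B] →* K where
  toFun := redNorm K
  map_one' := by simp [redNorm]
  map_mul' x y := by
    simp only [redNorm_eq, QuaternionAlgebra.re_mul, QuaternionAlgebra.imI_mul,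
      QuaternionAlgebra.imJ_mul, QuaternionAlgebra.imK_mul]
    ring

theorem redNorm_algebraMap {K : Type} [Field K] {A B : K} (r : K) :
    redNorm K (algebraMap K ℍ[K, A, B] r) = r ^ 2 := by
  simp [redNorm_eq]

theorem redNorm_nonneg {K : Type} [Field K] {A B : K} (σ : K →+* ℝ)
    (hA : σ A < 0) (hB : σ B < 0) (x : ℍ[K, A, B]) : 0 ≤ σ (redNorm K x) := by
  simp only [redNorm_eq, map_add, map_sub, map_mul, map_pow]
  have h₁ := mul_nonneg (neg_nonneg.2 hA.le) (sq_nonneg (σ x.imI))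
  have h₂ := mul_nonneg (neg_nonneg.2 hB.le) (sq_nonneg (σ x.imJ))
  have h₃ := mul_nonneg (mul_pos_of_neg_of_neg hA hB).le (sq_nonneg (σ x.imK))
  nlinarith [sq_nonneg (σ x.re)]

open scoped IsMulCommutative in
theorem isIntegral_mul_of_commute {S : Type*} [Ring S] {x y : S} (hxy : Commute x y)
    (hx : IsIntegral ℤ x) (hy : IsIntegral ℤ y) : IsIntegral ℤ (x * y) := by
  have hcomm : ∀ a ∈ ({x, y} : Set S), ∀ b ∈ ({x, y} : Set S), a * b = b * a := by
    rintro a (rfl | rfl) b (rfl | rfl)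
    exacts [rfl, hxy, hxy.symm, rfl]
  have : IsMulCommutative (Algebra.adjoin ℤ ({x, y} : Set S)) :=
    Algebra.isMulCommutative_adjoin ℤ hcomm
  let x' : Algebra.adjoin ℤ {x, y} := ⟨x, Algebra.subset_adjoin (by simp)⟩
  let y' : Algebra.adjoin ℤ {x, y} := ⟨y, Algebra.subset_adjoin (by simp)⟩
  have hx' : IsIntegral ℤ x' :=
    (isIntegral_algHom_iff (Subalgebra.val _) Subtype.val_injective).1 hx
  have hy' : IsIntegral ℤ y' :=
    (isIntegral_algHom_iff (Subalgebra.val _) Subtype.val_injective).1 hy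
  exact (hx'.mul hy').map (Algebra.adjoin ℤ {x, y}).val

theorem isIntegral_of_mem_fg {S : Type*} [Ring S] (O : Subring S) (hO : O.toAddSubgroup.FG)
    {x : S} (hx : x ∈ O) : IsIntegral ℤ x := by
  refine IsIntegral.of_mem_of_fg (subalgebraOfSubring O) ?_ x hx
  rw [Submodule.fg_iff_addSubgroup_fg]
  exact hO

theorem isIntegral_star {K : Type} [Field K] {A B : K} {x : ℍ[K, A, B]} (hx : IsIntegral ℤ x) :
    IsIntegral ℤ (star x) := by
  obtain ⟨p, hp, h⟩ := hx
  refine ⟨p, hp, ?_⟩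
  have := congrArg star h
  rw [Polynomial.eval₂_eq_sum_range] at this ⊢
  simpa [Polynomial.eval₂_eq_sum_range, star_sum, star_mul, (Int.cast_commute _ _).eq] using this

theorem isIntegral_redNorm {K : Type} [Field K] {A B : K} {x : ℍ[K, A, B]} (hx : IsIntegral ℤ x) :
    IsIntegral ℤ (redNorm K x) := by
  have h := isIntegral_mul_of_commute (show Commute x (star x) from (star_comm_self' x).symm) hx
    (isIntegral_star hx)
  rw [QuaternionAlgebra.mul_star_eq_coe] at h
  have hinj : Function.Injective (algebraMap K ℍ[K, A, B]) :=
    QuaternionAlgebra.coe_injective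
  exact (isIntegral_algHom_iff ((Algebra.ofId K ℍ[K, A, B]).restrictScalars ℤ) hinj).1 h

/-- Units of an order have reduced norm a unit of the ring of integers. -/
theorem exists_unit_eq_redNorm {K : Type} [Field K] {A B : K} {O : Subring ℍ[K, A, B]}
    (hO : O.toAddSubgroup.FG) (u : (↥O)ˣ) :
    ∃ v : (𝓞 K)ˣ, algebraMap (𝓞 K) K v = redNorm K ((u : ↥O) : ℍ[K, A, B]) := by
  have hint (w : ↥O) : IsIntegral ℤ (redNorm K (w : ℍ[K, A, B])) :=
    isIntegral_redNorm (isIntegral_of_mem_fg O hO w.2)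
  have hmul : redNorm K ((u : ↥O) : ℍ[K, A, B]) *
      redNorm K (((u⁻¹ : (↥O)ˣ) : ↥O) : ℍ[K, A, B]) = 1 := by
    have h := map_mul (redNormHom A B) ((u : ↥O) : ℍ[K, A, B]) ((u⁻¹ : (↥O)ˣ) : ↥O)
    rw [← Subring.coe_mul, Units.mul_inv, Subring.coe_one, map_one] at h
    exact h.symm
  exact ⟨Units.mkOfMulEqOne ⟨_, hint u⟩ ⟨_, hint (u⁻¹ : (↥O)ˣ)⟩ (Subtype.ext hmul), rfl⟩

theorem eq_zpow_of_isLeast_unit {K : Type} [Field K] {σ : K →+* ℝ} {ε : (𝓞 K)ˣ}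
    (hε : 1 < σ (algebraMap (𝓞 K) K ↑ε))
    (hmin : ∀ u : (𝓞 K)ˣ, 1 < σ (algebraMap (𝓞 K) K ↑u) →
      σ (algebraMap (𝓞 K) K ↑ε) ≤ σ (algebraMap (𝓞 K) K ↑u))
    (v : (𝓞 K)ˣ) (hv : 0 < σ (algebraMap (𝓞 K) K ↑v)) : ∃ n : ℤ, v = ε ^ n := by
  let τ : (𝓞 K)ˣ →* ℝˣ := Units.map (σ.comp (algebraMap (𝓞 K) K) : 𝓞 K →* ℝ)
  have hτ (u : (𝓞 K)ˣ) : (τ u : ℝ) = σ (algebraMap (𝓞 K) K ↑u) := rfl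
  simp only [← hτ] at hε hmin hv
  obtain ⟨n, h₁, h₂⟩ := exists_mem_Ico_zpow hv hε
  refine ⟨n, ?_⟩
  have hpos : (0 : ℝ) < (τ ε : ℝ) ^ n := zpow_pos (zero_lt_one.trans hε) n
  have hw : (τ (v * (ε ^ n)⁻¹) : ℝ) = (τ v : ℝ) / (τ ε : ℝ) ^ n := by
    simp [div_eq_mul_inv]
  have hle : (τ (v * (ε ^ n)⁻¹) : ℝ) ≤ 1 := by
    by_contra! h
    refine (hmin _ h).not_gt ?_
    rw [hw, div_lt_iff₀ hpos]
    rwa [zpow_add_one₀ (zero_lt_one.trans hε).ne', mul_comm] at h₂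
  have hone : (τ (v * (ε ^ n)⁻¹) : ℝ) = 1 :=
    le_antisymm hle (by rwa [hw, le_div_iff₀ hpos, one_mul])
  have hτinj : Function.Injective τ := Units.map_injective
    (σ.injective.comp (FaithfulSMul.algebraMap_injective (𝓞 K) K))
  have := hτinj (Units.ext (hone.trans (by simp)) : τ (v * (ε ^ n)⁻¹) = τ 1)
  exact mul_inv_eq_one.1 this

theorem norm_pos_of_forall_real_pos {K : Type} [Field K] [NumberField K] {d : ℕ} {s : K}
    (hs : s ^ 2 = (d : K)) (hgen : Algebra.adjoin ℚ {s} = ⊤)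
    {x : K} (hx : ∀ σ : K →+* ℝ, 0 < σ x) :
    0 < Algebra.norm ℚ x := by
  have hreal (φ : K →ₐ[ℚ] ℂ) : ComplexEmbedding.IsReal (φ : K →+* ℂ) := by
    have him : (starRingEnd ℂ) (φ s) = φ s := by
      have h : φ s ^ 2 = (d : ℂ) := by rw [← map_pow, hs, map_natCast]
      rw [Complex.conj_eq_iff_im]
      have hre := congrArg Complex.re h
      have him := congrArg Complex.im h
      simp only [sq, Complex.mul_re, Complex.mul_im, Complex.natCast_re,
        Complex.natCast_im] at hre him
      have hd : (0 : ℝ) ≤ d := d.cast_nonneg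
      by_contra hne
      have h0 : (φ s).re = 0 := by
        have : (φ s).re * (φ s).im = 0 := by linarith
        exact (mul_eq_zero.1 this).resolve_right hne
      rw [h0] at hre
      have := mul_self_pos.2 hne
      linarith
    let ψ : K →ₐ[ℚ] ℂ := ((starRingEnd ℂ).comp (φ : K →+* ℂ)).toRatAlgHom
    have hψ : ψ = φ := AlgHom.ext_of_adjoin_eq_top hgen (by
      rintro _ rfl
      exact him)
    rw [ComplexEmbedding.isReal_iff]
    ext y
    exact DFunLike.congr_fun hψ y
  have hprod : ((Algebra.norm ℚ x : ℚ) : ℂ) =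
      ((∏ φ : K →ₐ[ℚ] ℂ, (hreal φ).embedding x : ℝ) : ℂ) := by
    have h := Algebra.norm_eq_prod_embeddings ℚ ℂ x
    rw [eq_ratCast] at h
    rw [h, Complex.ofReal_prod]
    exact Finset.prod_congr rfl fun φ _ => ((hreal φ).coe_embedding_apply x).symm
  have h : ((Algebra.norm ℚ x : ℚ) : ℝ) = ∏ φ : K →ₐ[ℚ] ℂ, (hreal φ).embedding x := by
    exact_mod_cast hprod
  have hpos : (0 : ℝ) < (Algebra.norm ℚ x : ℚ) := h ▸ Finset.prod_pos fun φ _ => hx _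
  exact_mod_cast hpos

/-- A unit whose reduced norm is the square of a scalar unit is a product of a scalar unit and a
unit of reduced norm one. -/
theorem mem_closure_of_redNorm_eq_sq {K : Type} [Field K] {A B : K} {O : Subring ℍ[K, A, B]}
    (hO : scalarSet K ℍ[K, A, B] ⊆ ↑O) (u : (↥O)ˣ) (r : (𝓞 K)ˣ)
    (h : redNorm K ((u : ↥O) : ℍ[K, A, B]) = algebraMap (𝓞 K) K ↑r ^ 2) :
    u ∈ Subgroup.closure
      {u : (↥O)ˣ | IsScalarUnit K u ∨ redNorm K ((u : ↥O) : ℍ[K, A, B]) = 1} := by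
  let f : 𝓞 K →+* ↥O :=
    ((algebraMap K ℍ[K, A, B]).comp (algebraMap (𝓞 K) K)).codRestrict O
      fun x => hO (Set.mem_range_self x)
  let e : (𝓞 K)ˣ →* (↥O)ˣ := Units.map (f : 𝓞 K →* ↥O)
  have he (x : (𝓞 K)ˣ) : ((e x : ↥O) : ℍ[K, A, B]) =
      algebraMap K ℍ[K, A, B] (algebraMap (𝓞 K) K ↑x) := rfl
  have hne : algebraMap (𝓞 K) K ↑r ≠ 0 := by simp
  have hv : redNorm K (((e r)⁻¹ * u : (↥O)ˣ) : ℍ[K, A, B]) = 1 := by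
    have hm := map_mul (redNormHom A B) ((e r : ↥O) : ℍ[K, A, B])
      (((e r)⁻¹ * u : (↥O)ˣ) : ↥O)
    rw [← Subring.coe_mul, ← Units.val_mul, mul_inv_cancel_left] at hm
    change redNorm K _ = redNorm K _ * redNorm K _ at hm
    rw [h, he, redNorm_algebraMap] at hm
    exact (mul_eq_left₀ (pow_ne_zero 2 hne)).1 hm.symm
  rw [← mul_inv_cancel_left (e r) u]
  exact mul_mem (Subgroup.subset_closure (Or.inl ⟨r, he r⟩)) (Subgroup.subset_closure (Or.inr hv))

/-- **The Vignéras unit index of an order in a totally definite quaternion algebra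
over a real quadratic field is `1` or `2`.** -/
theorem vigneras_unit_index
    (d : ℕ) (hd2 : 2 ≤ d) (hdsf : Squarefree d)
    (sqrtd : F) (hsqrtd : sqrtd ^ 2 = (d : F))
    (hgen : Algebra.adjoin ℚ {sqrtd} = ⊤)
    (σ₀ : F →+* ℝ) (hσ₀ : 0 < σ₀ sqrtd)
    -- `ε` is the fundamental unit of `F`: the smallest unit greater than `1`
    (ε : (𝓞 F)ˣ) (hε : 1 < σ₀ (algebraMap (𝓞 F) F ↑ε))
    (hεfund : ∀ u : (𝓞 F)ˣ, 1 < σ₀ (algebraMap (𝓞 F) F ↑u) →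
      σ₀ (algebraMap (𝓞 F) F ↑ε) ≤ σ₀ (algebraMap (𝓞 F) F ↑u))
    -- `H = ℍ[F, A, B]` is a totally definite quaternion `F`-algebra (every totally
    -- definite quaternion algebra admits such a presentation)
    (A B : F) (hdef : ∀ σ : F →+* ℝ, σ A < 0 ∧ σ B < 0)
    -- `O` is an `O_F`-order in `H`
    (O : Subring ℍ[F, A, B]) (hO : IsOrder F O) :
    -- `T = O_F^× · O¹` is the subgroup of `O^×` generated by the scalar units and
    -- the units of reduced norm `1`
    let T : Subgroup (↥O)ˣ :=
      Subgroup.closure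
        {u : (↥O)ˣ | IsScalarUnit F u ∨ redNorm F ((u : ↥O) : ℍ[F, A, B]) = 1}
    (T.index = 1 ∨ T.index = 2) ∧
      (Algebra.norm ℚ (algebraMap (𝓞 F) F ↑ε) = -1 → T = ⊤) := by
  intro T
  have key (u : (↥O)ˣ) : ∃ n : ℤ, algebraMap (𝓞 F) F ↑(ε ^ n) =
      redNorm F ((u : ↥O) : ℍ[F, A, B]) := by
    obtain ⟨v, hv⟩ := exists_unit_eq_redNorm hO.2.1 u
    have hpos : 0 < σ₀ (algebraMap (𝓞 F) F ↑v) := by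
      refine lt_of_le_of_ne ?_ ((map_ne_zero _).2 (by simp)).symm
      rw [hv]
      exact redNorm_nonneg σ₀ (hdef σ₀).1 (hdef σ₀).2 _
    obtain ⟨n, rfl⟩ := eq_zpow_of_isLeast_unit hε hεfund v hpos
    exact ⟨n, hv⟩
  have even_mem (u : (↥O)ˣ) (n : ℤ) (hn : algebraMap (𝓞 F) F ↑(ε ^ n) =
      redNorm F ((u : ↥O) : ℍ[F, A, B])) (he : Even n) : u ∈ T := by
    obtain ⟨m, rfl⟩ := he
    refine mem_closure_of_redNorm_eq_sq hO.1 u (ε ^ m) ?_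
    rw [← hn, zpow_add, Units.val_mul, map_mul, sq]
  constructor
  · by_cases hT : T = ⊤
    · exact Or.inl (Subgroup.index_eq_one.2 hT)
    · right
      obtain ⟨a, ha⟩ : ∃ a, a ∉ T := by
        by_contra! h
        exact hT ((Subgroup.eq_top_iff' T).2 h)
      refine Subgroup.index_eq_two_iff_exists_notMem_and.2 ⟨a, ha, fun b => ?_⟩
      by_contra! h
      obtain ⟨n, hn⟩ := key a
      obtain ⟨m, hm⟩ := key b
      refine h.1 (even_mem _ (m + n) ?_ ?_)
      · have hmul := map_mul (redNormHom A B) ((b : ↥O) : ℍ[F, A, B]) (a : ↥O)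
        rw [zpow_add, Units.val_mul, map_mul, hn, hm]
        exact hmul.symm
      · exact (Int.not_even_iff_odd.1 fun he => h.2 (even_mem b m hm he)).add_odd
          (Int.not_even_iff_odd.1 fun he => ha (even_mem a n hn he))
  · intro hnorm
    refine (Subgroup.eq_top_iff' T).2 fun u => ?_
    obtain ⟨n, hn⟩ := key u
    refine even_mem u n hn ?_
    have hpos : 0 < Algebra.norm ℚ (algebraMap (𝓞 F) F ↑(ε ^ n)) := by
      refine norm_pos_of_forall_real_pos hsqrtd hgen fun σ => ?_
      refine lt_of_le_of_ne ?_ ((map_ne_zero _).2 (by simp)).symm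
      rw [hn]
      exact redNorm_nonneg σ (hdef σ).1 (hdef σ).2 _
    by_contra ho
    have hz : Algebra.norm ℚ (algebraMap (𝓞 F) F ↑(ε ^ n)) = (-1) ^ n := by
      let N : (𝓞 F)ˣ →* ℚˣ :=
        Units.map ((Algebra.norm ℚ).comp (algebraMap (𝓞 F) F : 𝓞 F →* F))
      have h := congrArg Units.val (map_zpow N ε n)
      rw [Units.val_zpow_eq_zpow_val] at h
      rw [← hnorm]
      exact h
    rw [hz, (Int.not_even_iff_odd.1 ho).neg_one_zpow] at hpos
    norm_num at hpos

end QuatPaper
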